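/- arXiv:2003.01964 — 3 statements merged into one kernel-verified Lean document; each statement's English description precedes it below -/
import Mathlib

section
/- Let h : X → PMF(Bool × X) be an exchangeable coalgebra. Then for every K ∈ ℕ, x ∈ X and k ≤ K, the probability of seeing k ones among K outputs satisfies h_K(x)(k) = C(K,k) · h♯_K(x)(1,…,1,0,…,0), where the tuple has k ones followed by K−k zeros. -/
open scoped ENNReal

/-- A coalgebra `h : X → PMF (Bool × X)` is exchangeable if the distribution of
(first output, second output, final state) under two successive steps equals the
distribution of (second output, first output, final state). -/
def Exchangeable {X : Type*} (h : X → PMF (Bool × X)) : Prop :=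
  ∀ x : X,
    ((h x).bind fun p => (h p.2).map fun q => (p.1, q.1, q.2))
      = (h x).bind fun p => (h p.2).map fun q => (q.1, p.1, q.2)

/-- `h♯^K(x)`: the distribution of the `K`-tuple of outputs together with the final
state, obtained by iterating the coalgebra `h` for `K` steps from `x`. -/
noncomputable def iterSharp {X : Type*} (h : X → PMF (Bool × X)) :
    (K : ℕ) → X → PMF ((Fin K → Bool) × X)
  | 0, x => PMF.pure (Fin.elim0, x)
  | K + 1, x =>
      (iterSharp h K x).bind fun p =>
        (h p.2).map fun q => (Fin.snoc p.1 q.1, q.2)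

/-- `h♯_K(x)`: the distribution of the first `K` outputs of the coalgebra `h` from `x`. -/
noncomputable def outputs {X : Type*} (h : X → PMF (Bool × X)) (K : ℕ) (x : X) :
    PMF (Fin K → Bool) :=
  (iterSharp h K x).map Prod.fst

/-- `h_K(x)(k)`: the probability that exactly `k` of the first `K` outputs equal `true`. -/
noncomputable def countDist {X : Type*} (h : X → PMF (Bool × X)) (K : ℕ) (x : X) (k : ℕ) :
    ℝ≥0∞ :=
  ∑ b ∈ Finset.univ.filter
      (fun b : Fin K → Bool => (Finset.univ.filter fun i => b i = true).card = k),
    outputs h K x b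

/-- The expectation of `g` under `p`. -/
noncomputable def PMF.expect {α : Type*} (p : PMF α) (g : α → ℝ≥0∞) : ℝ≥0∞ :=
  ∑' a, p a * g a

namespace PMF

variable {α β : Type*}

theorem expect_pure (a : α) (g : α → ℝ≥0∞) : (PMF.pure a).expect g = g a := by
  rw [expect, tsum_eq_single a]
  · simp
  · intro b hb
    simp [hb]

theorem expect_bind (p : PMF α) (F : α → PMF β) (g : β → ℝ≥0∞) :
    (p.bind F).expect g = p.expect fun a => (F a).expect g := by
  simp only [expect, PMF.bind_apply, ← ENNReal.tsum_mul_right, ← ENNReal.tsum_mul_left]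
  rw [ENNReal.tsum_comm]
  simp only [mul_assoc]

theorem expect_map (p : PMF α) (F : α → β) (g : β → ℝ≥0∞) :
    (p.map F).expect g = p.expect fun a => g (F a) := by
  rw [← PMF.bind_pure_comp, expect_bind]
  simp only [Function.comp_apply, expect_pure]

theorem expect_zero (p : PMF α) : (p.expect fun _ => 0) = 0 := by
  simp [expect]

theorem expect_ite_eq [DecidableEq α] (p : PMF α) (a : α) :
    (p.expect fun c => if c = a then 1 else 0) = p a := by
  rw [expect, tsum_eq_single a]
  · simp
  · intro b hb
    simp [hb]

end PMF

/-- The expectation of `f` at the state reached from `x` after one step of `h`, restricted to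
the event that this step outputs `b`. -/
noncomputable def stepExpect {X : Type*} (h : X → PMF (Bool × X)) (b : Bool)
    (f : X → ℝ≥0∞) (x : X) : ℝ≥0∞ :=
  (h x).expect fun q => if q.1 = b then f q.2 else 0

theorem Exchangeable.leftCommutative {X : Type*} {h : X → PMF (Bool × X)}
    (hex : Exchangeable h) : LeftCommutative (stepExpect h) := by
  have key (a b : Bool) (f : X → ℝ≥0∞) (x : X) :
      stepExpect h a (stepExpect h b f) x =
        (h x).expect fun p => (h p.2).expect fun q =>
          if p.1 = a ∧ q.1 = b then f q.2 else 0 := by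
    rw [stepExpect]
    congr 1
    funext p
    by_cases hp : p.1 = a
    · simp [hp, stepExpect]
    · simp [hp, PMF.expect_zero]
  refine ⟨fun a b f => funext fun x => ?_⟩
  have hx := congrArg
    (fun p : PMF (Bool × Bool × X) =>
      p.expect fun t => if t.1 = a ∧ t.2.1 = b then f t.2.2 else 0) (hex x)
  simp only [PMF.expect_bind, PMF.expect_map] at hx
  rw [key, key, hx]
  simp only [and_comm]

theorem iterSharp_expect {X : Type*} (h : X → PMF (Bool × X)) (K : ℕ) (x : X)
    (b : Fin K → Bool) (f : X → ℝ≥0∞) :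
    ((iterSharp h K x).expect fun p => if p.1 = b then f p.2 else 0) =
      (List.ofFn b).foldr (stepExpect h) f x := by
  induction K generalizing f with
  | zero =>
    rw [iterSharp, PMF.expect_pure, if_pos (Subsingleton.elim _ _)]
    simp
  | succ K ih =>
    rw [List.ofFn_succ', List.concat_eq_append, List.foldr_append, ← ih, iterSharp,
      PMF.expect_bind]
    congr 1
    funext p
    have hsnoc (c : Bool) : (Fin.snoc p.1 c : Fin (K + 1) → Bool) = b ↔
        (p.1 = fun i => b i.castSucc) ∧ c = b (Fin.last K) := by
      constructor
      · rintro rfl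
        simp
      · rintro ⟨hp, rfl⟩
        rw [hp]
        exact Fin.snoc_init_self b
    rw [PMF.expect_map]
    simp only [hsnoc]
    by_cases hp : p.1 = fun i => b i.castSucc
    · simp [hp, stepExpect]
    · simp [hp, PMF.expect_zero]

theorem outputs_eq_foldr {X : Type*} (h : X → PMF (Bool × X)) (K : ℕ) (x : X)
    (b : Fin K → Bool) :
    outputs h K x b = (List.ofFn b).foldr (stepExpect h) (fun _ => 1) x := by
  rw [← iterSharp_expect, ← PMF.expect_ite_eq (outputs h K x) b, outputs, PMF.expect_map]

theorem Exchangeable.outputs_comp_perm {X : Type*} {h : X → PMF (Bool × X)}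
    (hex : Exchangeable h) (K : ℕ) (x : X) (b : Fin K → Bool) (σ : Equiv.Perm (Fin K)) :
    outputs h K x (b ∘ σ) = outputs h K x b := by
  have := hex.leftCommutative
  rw [outputs_eq_foldr, outputs_eq_foldr, (σ.ofFn_comp_perm b).foldr_eq]

theorem exists_perm_comp_eq_of_card_true_eq {ι : Type*} [Fintype ι] {b c : ι → Bool}
    (hbc : (Finset.univ.filter fun i => b i = true).card =
      (Finset.univ.filter fun i => c i = true).card) :
    ∃ σ : Equiv.Perm ι, c ∘ σ = b := by
  classical
  let e : {i // b i = true} ≃ {i // c i = true} :=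
    Fintype.equivOfCardEq (by simpa [Fintype.card_subtype] using hbc)
  refine ⟨e.extendSubtype, funext fun i => ?_⟩
  by_cases hi : b i = true
  · simpa [hi] using e.extendSubtype_mem i hi
  · simpa [hi] using e.extendSubtype_not_mem i hi

theorem card_filter_card_true_eq (ι : Type*) [Fintype ι] [DecidableEq ι] (k : ℕ) :
    (Finset.univ.filter fun b : ι → Bool =>
      (Finset.univ.filter fun i => b i = true).card = k).card = (Fintype.card ι).choose k := by
  rw [← Finset.card_univ, ← Finset.card_powersetCard]
  refine Finset.card_nbij' (fun b => Finset.univ.filter fun i => b i = true)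
    (fun s i => decide (i ∈ s)) ?_ ?_ ?_ ?_
  · intro b hb
    simpa using hb
  · intro s hs
    simpa using hs
  · intro b _
    simp
  · intro s _
    simp

/-- For an exchangeable coalgebra, the probability of seeing `k` ones among `K` outputs
is `C(K,k)` times the probability of the particular tuple with `k` ones followed by
`K−k` zeros. -/
theorem countDist_eq_choose_mul {X : Type*} (h : X → PMF (Bool × X))
    (hex : Exchangeable h) (K : ℕ) (x : X) (k : ℕ) (hk : k ≤ K) :
    countDist h K x k
      = (K.choose k : ℝ≥0∞) * outputs h K x (fun i => decide ((i : ℕ) < k)) := by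
  have hcard : (Finset.univ.filter fun i : Fin K => decide ((i : ℕ) < k) = true).card = k := by
    simp [Fin.card_filter_val_lt, hk]
  rw [countDist, Finset.sum_congr rfl fun b hb => ?_, Finset.sum_const,
    card_filter_card_true_eq, Fintype.card_fin, nsmul_eq_mul]
  obtain ⟨σ, rfl⟩ := exists_perm_comp_eq_of_card_true_eq
    ((Finset.mem_filter.mp hb).2.trans hcard.symm)
  exact hex.outputs_comp_perm K x _ σ
end

section
/- Let h : X → PMF(Bool × X) be an exchangeable coalgebra. Then the channels h_K form a cone over the draw-and-delete chain: for every K ∈ ℕ, x ∈ X and k ≤ K, ((k+1)/(K+1)) · h_{K+1}(x)(k+1) + ((K+1−k)/(K+1)) · h_{K+1}(x)(k) = h_K(x)(k). -/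
open scoped ENNReal

/-- The operator sending `g` to `x ↦ ∑' y, h x (c, y) * g y`: the expectation of `g` at the next
state, restricted to the event that the output is `c`. -/
noncomputable def outputOp {X : Type*} (h : X → PMF (Bool × X)) (c : Bool) :
    AddMonoid.End (X → ℝ≥0∞) where
  toFun g x := ∑' y, h x (c, y) * g y
  map_zero' := by ext; simp
  map_add' f g := by ext; simp [mul_add, ENNReal.tsum_add]

theorem AddMonoid.End.mul_apply {M : Type*} [AddZeroClass M] (f g : AddMonoid.End M) (a : M) :
    (f * g) a = f (g a) := rfl

theorem outputOp_apply {X : Type*} (h : X → PMF (Bool × X)) (c : Bool) (g : X → ℝ≥0∞) (x : X) :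
    outputOp h c g x = ∑' y, h x (c, y) * g y := rfl

theorem ENNReal.tsum_prod_mk {α β : Type*} (f : α × β → ℝ≥0∞) :
    ∑' p, f p = ∑' a, ∑' b, f (a, b) :=
  ENNReal.tsum_prod (f := fun a b => f (a, b))

theorem PMF.map_pair_apply {X : Type*} (p : PMF (Bool × X)) {α : Type*} (f : Bool → α)
    (hf : Function.Injective f) (c : Bool) (y : X) :
    (p.map fun q => (f q.1, q.2)) (f c, y) = p (c, y) := by
  classical
  rw [PMF.map_apply, tsum_eq_single (c, y)]
  · simp
  · rintro ⟨c', y'⟩ hne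
    rw [if_neg]
    intro he
    simp only [Prod.mk.injEq, hf.eq_iff] at he
    exact hne (by rw [he.1, he.2])

theorem Exchangeable.tsum_mul_comm {X : Type*} {h : X → PMF (Bool × X)} (hex : Exchangeable h)
    (x z : X) :
    ∑' y, h x (true, y) * h y (false, z) = ∑' y, h x (false, y) * h y (true, z) := by
  classical
  have key (b : Bool) (p : PMF (Bool × X)) :
      (∑' q : Bool × X, if b = q.1 ∧ z = q.2 then p q else 0) = p (b, z) := by
    simpa [PMF.map_apply, Prod.ext_iff] using PMF.map_pair_apply p id Function.injective_id b z
  have e := congrArg (fun p => p (true, false, z)) (hex x)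
  simp only [PMF.bind_apply, PMF.map_apply, ENNReal.tsum_prod_mk (fun a => h x a * _), tsum_bool,
    Prod.mk.injEq, Bool.true_eq_false, Bool.false_eq_true, false_and, and_false, true_and,
    if_false, tsum_zero, mul_zero, zero_add, add_zero, and_left_comm, key] at e
  exact e

theorem Exchangeable.commute_outputOp {X : Type*} {h : X → PMF (Bool × X)}
    (hex : Exchangeable h) : Commute (outputOp h true) (outputOp h false) := by
  ext g x
  simp only [AddMonoid.End.mul_apply, outputOp_apply, ← ENNReal.tsum_mul_left, ← mul_assoc]
  rw [ENNReal.tsum_comm, ENNReal.tsum_comm (f := fun y z => h x (false, y) * _ * _)]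
  simp only [ENNReal.tsum_mul_right, hex.tsum_mul_comm]

theorem outputOp_true_add_false_one {X : Type*} (h : X → PMF (Bool × X)) :
    outputOp h true 1 + outputOp h false 1 = 1 := by
  ext x
  have e := (h x).tsum_coe
  rw [ENNReal.tsum_prod_mk, tsum_bool] at e
  simpa [outputOp_apply, add_comm] using e

theorem iterSharp_succ_apply_snoc {X : Type*} (h : X → PMF (Bool × X)) (K : ℕ) (x : X)
    (b : Fin K → Bool) (c : Bool) (y : X) :
    iterSharp h (K + 1) x (Fin.snoc b c, y) = ∑' z, iterSharp h K x (b, z) * h z (c, y) := by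
  classical
  simp only [iterSharp, PMF.bind_apply]
  rw [ENNReal.tsum_prod_mk, tsum_eq_single b]
  · refine tsum_congr fun z => ?_
    congr 1
    exact PMF.map_pair_apply (h z) (Fin.snoc (α := fun _ => Bool) b)
      (Fin.snoc_right_injective (α := fun _ => Bool) b) c y
  · intro b' hb
    refine ENNReal.tsum_eq_zero.2 fun z => ?_
    rw [PMF.map_apply]
    simp only [Prod.mk.injEq, Fin.snoc_inj, Ne.symm hb, false_and, if_false, tsum_zero, mul_zero]

/-- The number of entries of `b` equal to `true`. -/
def trueCount {K : ℕ} (b : Fin K → Bool) : ℕ :=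
  (Finset.univ.filter fun i => b i = true).card

theorem trueCount_snoc {K : ℕ} (b : Fin K → Bool) (c : Bool) :
    trueCount (Fin.snoc (α := fun _ => Bool) b c) = trueCount b + c.toNat := by
  simp only [trueCount, Finset.card_filter, Fin.sum_univ_castSucc, Fin.snoc_castSucc, Fin.snoc_last]
  cases c <;> simp

theorem trueCount_le {K : ℕ} (b : Fin K → Bool) : trueCount b ≤ K :=
  (Finset.card_filter_le _ _).trans (by simp)

theorem card_trueCount_eq (K k : ℕ) :
    (Finset.univ.filter fun b : Fin K → Bool => trueCount b = k).card = K.choose k := by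
  have hc : (Finset.powersetCard k (Finset.univ : Finset (Fin K))).card = K.choose k := by simp
  rw [← hc]
  refine Finset.card_bij' (fun b _ => Finset.univ.filter fun i => b i = true)
    (fun s _ i => decide (i ∈ s)) (fun b hb => ?_) (fun s hs => ?_) (fun b _ => by simp)
    (fun s _ => by simp)
  · exact Finset.mem_powersetCard.2 ⟨Finset.subset_univ _, (Finset.mem_filter.1 hb).2⟩
  · refine Finset.mem_filter.2 ⟨Finset.mem_univ _, ?_⟩
    simpa [trueCount] using (Finset.mem_powersetCard.1 hs).2

theorem Exchangeable.tsum_iterSharp_mul {X : Type*} {h : X → PMF (Bool × X)}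
    (hex : Exchangeable h) (x : X) (K : ℕ) (b : Fin K → Bool) (g : X → ℝ≥0∞) :
    ∑' y, iterSharp h K x (b, y) * g y
      = (outputOp h true ^ trueCount b * outputOp h false ^ (K - trueCount b)) g x := by
  classical
  induction K generalizing g with
  | zero =>
    rw [tsum_eq_single x fun y hy => by simp [iterSharp, PMF.pure_apply, hy]]
    simp [iterSharp, trueCount, PMF.pure_apply, Subsingleton.elim b Fin.elim0]
  | succ K ih =>
    induction b using Fin.snocCases with
    | _ b c =>
    have step : ∑' y, iterSharp h (K + 1) x (Fin.snoc b c, y) * g y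
        = ∑' z, iterSharp h K x (b, z) * outputOp h c g z := by
      simp only [iterSharp_succ_apply_snoc, ← ENNReal.tsum_mul_right, outputOp_apply,
        ← ENNReal.tsum_mul_left, mul_assoc]
      exact ENNReal.tsum_comm
    rw [step, ih, ← AddMonoid.End.mul_apply, trueCount_snoc]
    have hle := trueCount_le b
    cases c with
    | true =>
      rw [Bool.toNat_true, pow_succ, mul_assoc, mul_assoc, Nat.add_sub_add_right,
        (hex.commute_outputOp.pow_right _).eq]
    | false =>
      rw [Bool.toNat_false, add_zero, mul_assoc, ← pow_succ, Nat.sub_add_comm hle]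

theorem outputs_apply {X : Type*} (h : X → PMF (Bool × X)) (K : ℕ) (x : X) (b : Fin K → Bool) :
    outputs h K x b = ∑' y, iterSharp h K x (b, y) := by
  classical
  rw [outputs, PMF.map_apply, ENNReal.tsum_prod_mk, tsum_eq_single b]
  · simp
  · intro b' hb
    simp [Ne.symm hb]

theorem Exchangeable.countDist_eq {X : Type*} {h : X → PMF (Bool × X)}
    (hex : Exchangeable h) (K : ℕ) (x : X) (k : ℕ) :
    countDist h K x k
      = K.choose k * (outputOp h true ^ k * outputOp h false ^ (K - k)) 1 x := by
  rw [← card_trueCount_eq, ← nsmul_eq_mul]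
  refine Finset.sum_eq_card_nsmul fun b hb => ?_
  obtain rfl : trueCount b = k := (Finset.mem_filter.1 hb).2
  rw [outputs_apply, ← hex.tsum_iterSharp_mul]
  simp

/-- For an exchangeable coalgebra `h`, the channels `h_K` form a cone over the
draw-and-delete chain: `((k+1)/(K+1))·h_{K+1}(x)(k+1) + ((K+1−k)/(K+1))·h_{K+1}(x)(k)
= h_K(x)(k)`. -/
theorem countDist_cone {X : Type*} (h : X → PMF (Bool × X))
    (hex : Exchangeable h) (K : ℕ) (x : X) (k : ℕ) (hk : k ≤ K) :
    (((k : ℝ≥0∞) + 1) / ((K : ℝ≥0∞) + 1)) * countDist h (K + 1) x (k + 1)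
        + ((((K : ℝ≥0∞) + 1) - (k : ℝ≥0∞)) / ((K : ℝ≥0∞) + 1)) * countDist h (K + 1) x k
      = countDist h K x k := by
  have hK : (K : ℝ≥0∞) + 1 ≠ 0 := by simp
  have hK' : (K : ℝ≥0∞) + 1 ≠ ∞ := by simp
  have hsplit : (outputOp h true ^ k * outputOp h false ^ (K - k)) 1 x
      = (outputOp h true ^ (k + 1) * outputOp h false ^ (K + 1 - (k + 1))) 1 x
        + (outputOp h true ^ k * outputOp h false ^ (K + 1 - k)) 1 x := by
    conv_lhs => rw [← outputOp_true_add_false_one h, map_add, Pi.add_apply,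
      ← AddMonoid.End.mul_apply, ← AddMonoid.End.mul_apply]
    congr 3
    · rw [Nat.add_sub_add_right, pow_succ, mul_assoc, mul_assoc,
        (hex.commute_outputOp.pow_right _).eq]
    · rw [mul_assoc, ← pow_succ, Nat.sub_add_comm hk]
  have hadd : ((k : ℝ≥0∞) + 1) / ((K : ℝ≥0∞) + 1) * ((K + 1).choose (k + 1) : ℕ)
      = (K.choose k : ℕ) := by
    rw [← ENNReal.mul_div_right_comm, eq_comm, ENNReal.eq_div_iff hK hK', mul_comm ((k : ℝ≥0∞) + 1)]
    exact_mod_cast Nat.add_one_mul_choose_eq K k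
  have hdel : (((K : ℝ≥0∞) + 1) - k) / ((K : ℝ≥0∞) + 1) * ((K + 1).choose k : ℕ)
      = (K.choose k : ℕ) := by
    rw [← ENNReal.mul_div_right_comm, eq_comm, ENNReal.eq_div_iff hK hK', mul_comm,
      mul_comm _ ((K + 1).choose k : ℝ≥0∞)]
    exact_mod_cast Nat.choose_mul_succ_eq K k
  rw [hex.countDist_eq, hex.countDist_eq, hex.countDist_eq, ← mul_assoc, ← mul_assoc, hadd, hdel,
    ← mul_add, ← hsplit]
end

section
/- (De Finetti, kernel/limit form) Let Y be a measurable space and for each K ∈ ℕ let c_K be a Markov kernel from Y to {0,…,K} (with the discrete σ-algebra), such that for all y ∈ Y, K ∈ ℕ and i ≤ K: c_K(y)({i}) = ((i+1)/(K+1)) · c_{K+1}(y)({i+1}) + ((K+1−i)/(K+1)) · c_{K+1}(y)({i}). Then there exists a unique Markov kernel c from Y to [0,1] (with the Borel σ-algebra) such that for all y, K and k ≤ K: c_K(y)({k}) = ∫_0^1 C(K,k) · x^k · (1−x)^{K−k} d(c(y))(x). Hence the unit interval with the binomial channels is the limit of the draw-and-delete chain in the Kleisli category of the Giry monad. -/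
open MeasureTheory ProbabilityTheory
open scoped ENNReal
open Filter Topology unitInterval

/-- An array of real numbers compatible with the draw-and-delete channels, with denominators
cleared. -/
def IsDrawDeleteCone (p : ℕ → ℕ → ℝ) : Prop :=
  ∀ K i : ℕ, i ≤ K →
    ((K : ℝ) + 1) * p K i = ((i : ℝ) + 1) * p (K + 1) (i + 1) + ((K : ℝ) + 1 - i) * p (K + 1) i

/-- The factorial moments of the rows of a draw-and-delete cone. -/
theorem IsDrawDeleteCone.sum_descFactorial_mul {p : ℕ → ℕ → ℝ} (hp : IsDrawDeleteCone p)
    {j N : ℕ} (hjN : j ≤ N) :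
    ∑ l ∈ Finset.range (N + 1), (l.descFactorial j : ℝ) * p N l
      = (N.descFactorial j : ℝ) * p j j := by
  induction N, hjN using Nat.le_induction with
  | base =>
    rw [Finset.sum_range_succ, Finset.sum_eq_zero, zero_add]
    intro l hl
    rw [Nat.descFactorial_of_lt (Finset.mem_range.1 hl)]
    simp
  | succ N hN ih =>
    have hdesc (i : ℕ) : ((i : ℝ) + 1 - j) * ((i + 1).descFactorial j : ℝ)
        = ((i : ℝ) + 1) * (i.descFactorial j : ℝ) := by
      rcases le_or_gt j (i + 1) with h | h
      · have := Nat.succ_descFactorial i j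
        rw [← Nat.cast_inj (R := ℝ)] at this
        push_cast [Nat.cast_sub h] at this
        exact this
      · rw [Nat.descFactorial_of_lt h, Nat.descFactorial_of_lt (by omega)]
        simp
    have hzero : ((0 : ℕ) : ℝ) * ((0 : ℕ).descFactorial j : ℝ) = (j : ℝ) * (0 : ℕ).descFactorial j := by
      cases j <;> simp
    have hstep : ((N : ℝ) + 1) * ∑ l ∈ Finset.range (N + 1), (l.descFactorial j : ℝ) * p N l
        = ((N : ℝ) + 1 - j)
          * ∑ l ∈ Finset.range (N + 1 + 1), (l.descFactorial j : ℝ) * p (N + 1) l := by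
      have h₁ : ∑ i ∈ Finset.range (N + 1),
            ((i : ℝ) + 1) * (i.descFactorial j : ℝ) * p (N + 1) (i + 1)
          = ∑ l ∈ Finset.range (N + 1 + 1),
            ((l : ℝ) - j) * (l.descFactorial j : ℝ) * p (N + 1) l := by
        rw [Finset.sum_range_succ' _ (N + 1)]
        simp_rw [← hdesc]
        rw [sub_mul, hzero]
        simp
      have h₂ : ∑ i ∈ Finset.range (N + 1),
            ((N : ℝ) + 1 - i) * (i.descFactorial j : ℝ) * p (N + 1) i
          = ∑ l ∈ Finset.range (N + 1 + 1),
            ((N : ℝ) + 1 - l) * (l.descFactorial j : ℝ) * p (N + 1) l := by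
        rw [Finset.sum_range_succ _ (N + 1)]
        simp
      calc _ = ∑ i ∈ Finset.range (N + 1),
                (((i : ℝ) + 1) * (i.descFactorial j : ℝ) * p (N + 1) (i + 1)
                  + ((N : ℝ) + 1 - i) * (i.descFactorial j : ℝ) * p (N + 1) i) := by
            rw [Finset.mul_sum]
            refine Finset.sum_congr rfl fun i hi ↦ ?_
            have := hp N i (by simpa [Nat.lt_succ_iff] using hi)
            linear_combination (i.descFactorial j : ℝ) * this
        _ = _ := by
            rw [Finset.sum_add_distrib, h₁, h₂, ← Finset.sum_add_distrib, Finset.mul_sum]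
            exact Finset.sum_congr rfl fun i _ ↦ by ring
    have hpos : (0 : ℝ) < (N : ℝ) + 1 - j := by
      have : (j : ℝ) ≤ N := by exact_mod_cast hN
      linarith
    apply mul_left_cancel₀ hpos.ne'
    rw [← hstep, ih]
    linear_combination (-p j j) * hdesc N

/-- A draw-and-delete cone is determined by its diagonal. -/
theorem IsDrawDeleteCone.eq_of_diag {p q : ℕ → ℕ → ℝ} (hp : IsDrawDeleteCone p)
    (hq : IsDrawDeleteCone q) (h : ∀ j, p j j = q j j) {K k : ℕ} (hk : k ≤ K) :
    p K k = q K k := by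
  obtain ⟨d, rfl⟩ := Nat.exists_eq_add_of_le hk
  clear hk
  induction d generalizing k with
  | zero => exact h k
  | succ d ih =>
    have h₁ := hp (k + d) k (by omega)
    have h₂ := hq (k + d) k (by omega)
    have h₃ := ih (k := k + 1)
    rw [show k + 1 + d = k + d + 1 by omega] at h₃
    rw [ih, h₂, h₃] at h₁
    have hpos : ((k + d : ℕ) : ℝ) + 1 - k ≠ 0 := by
      push_cast
      have : (0 : ℝ) ≤ d := d.cast_nonneg
      exact ne_of_gt (by linarith)
    exact (mul_left_cancel₀ hpos (add_left_cancel h₁)).symm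

/-- The binomial probabilities satisfy the draw-and-delete relation pointwise. -/
theorem isDrawDeleteCone_bernstein (x : I) : IsDrawDeleteCone fun K k ↦ bernstein K k x := by
  intro K i hi
  have h₁ : ((i : ℝ) + 1) * ((K + 1).choose (i + 1) : ℝ) = ((K : ℝ) + 1) * (K.choose i : ℝ) := by
    have := Nat.add_one_mul_choose_eq K i
    rw [← Nat.cast_inj (R := ℝ)] at this
    push_cast at this
    linear_combination -this
  have h₂ : ((K : ℝ) + 1 - i) * ((K + 1).choose i : ℝ) = ((K : ℝ) + 1) * (K.choose i : ℝ) := by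
    have := Nat.choose_mul_succ_eq K i
    rw [← Nat.cast_inj (R := ℝ)] at this
    push_cast [Nat.cast_sub (show i ≤ K + 1 by omega)] at this
    linear_combination -this
  simp only [bernstein_apply]
  rw [show K + 1 - (i + 1) = K - i by omega, show K + 1 - i = K - i + 1 by omega]
  linear_combination (-(x : ℝ) ^ (i + 1) * (1 - (x : ℝ)) ^ (K - i)) * h₁
    - ((x : ℝ) ^ i * (1 - (x : ℝ)) ^ (K - i + 1)) * h₂

theorem isDrawDeleteCone_integral_bernstein (μ : Measure I) [IsFiniteMeasure μ] :
    IsDrawDeleteCone fun K k ↦ ∫ x, bernstein K k x ∂μ := by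
  intro K i hi
  have hint (n k : ℕ) : Integrable (fun x ↦ bernstein n k x) μ :=
    (bernstein n k).continuous.integrable_of_hasCompactSupport
      (HasCompactSupport.of_compactSpace _)
  simp only
  rw [← integral_const_mul, ← integral_const_mul, ← integral_const_mul, ← integral_add
    ((hint _ _).const_mul _) ((hint _ _).const_mul _)]
  exact integral_congr_ae (.of_forall fun x ↦ isDrawDeleteCone_bernstein x K i hi)

/-- Sampling without replacement is close to sampling with replacement. -/
theorem abs_descFactorial_div_sub_pow_le {j N l : ℕ} (hj : j ≤ N) (hl : l ≤ N) :
    |(l.descFactorial j : ℝ) / N.descFactorial j - ((l : ℝ) / N) ^ j|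
      ≤ ∑ i ∈ Finset.range j, (i : ℝ) / (N - i) := by
  induction j with
  | zero => simp
  | succ j ih =>
    have hjN : (j : ℝ) < N := by exact_mod_cast hj
    have hlN : (l : ℝ) ≤ N := by exact_mod_cast hl
    have hN : (0 : ℝ) < N := lt_of_le_of_lt (by positivity) hjN
    have hNj : (0 : ℝ) < N - j := by linarith
    rw [Finset.sum_range_succ, Nat.descFactorial_succ, Nat.descFactorial_succ, pow_succ']
    push_cast
    rw [Nat.cast_sub (show j ≤ N by omega), mul_div_mul_comm]
    set a : ℝ := ((l - j : ℕ) : ℝ) / ((N : ℝ) - j)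
    set b : ℝ := (l.descFactorial j : ℝ) / N.descFactorial j
    have hy0 : 0 ≤ (l : ℝ) / N := by positivity
    have hy1 : (l : ℝ) / N ≤ 1 := div_le_one_of_le₀ hlN hN.le
    have ha0 : 0 ≤ a := by positivity
    have hb0 : 0 ≤ b := by positivity
    have hb1 : b ≤ 1 := by
      apply div_le_one_of_le₀ _ (by positivity)
      exact_mod_cast Nat.descFactorial_le j hl
    have hab : |a - (l : ℝ) / N| ≤ (j : ℝ) / (N - j) := by
      rcases le_or_gt j l with h | h
      · have hjl : (j : ℝ) ≤ l := by exact_mod_cast h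
        have : a - (l : ℝ) / N = -(((j : ℝ) / (N - j)) * ((N - l) / N)) := by
          simp only [a]
          rw [Nat.cast_sub h]
          field_simp
          ring
        rw [this, abs_neg, abs_of_nonneg (by
          have : (0 : ℝ) ≤ N - l := by linarith
          positivity)]
        apply mul_le_of_le_one_right (by positivity)
        apply div_le_one_of_le₀ _ hN.le
        have : (0 : ℝ) ≤ l := by positivity
        linarith
      · have hjl : (l : ℝ) ≤ j := by exact_mod_cast h.le
        have : a = 0 := by simp [a, Nat.sub_eq_zero_of_le h.le]
        rw [this, zero_sub, abs_neg, abs_of_nonneg hy0]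
        gcongr
        linarith [(Nat.cast_nonneg j : (0 : ℝ) ≤ j)]
    calc |a * b - (l : ℝ) / N * ((l : ℝ) / N) ^ j|
        = |(l : ℝ) / N * (b - ((l : ℝ) / N) ^ j) + (a - (l : ℝ) / N) * b| := by
          congr 1; ring
      _ ≤ |(l : ℝ) / N * (b - ((l : ℝ) / N) ^ j)| + |(a - (l : ℝ) / N) * b| := abs_add_le _ _
      _ = (l : ℝ) / N * |b - ((l : ℝ) / N) ^ j| + |a - (l : ℝ) / N| * b := by
          rw [abs_mul, abs_mul, abs_of_nonneg hy0, abs_of_nonneg hb0]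
      _ ≤ 1 * |b - ((l : ℝ) / N) ^ j| + |a - (l : ℝ) / N| * 1 := by gcongr
      _ ≤ _ := by
          rw [one_mul, mul_one]
          exact add_le_add (ih (by omega)) hab

theorem tendsto_sum_div_sub_atTop (j : ℕ) :
    Tendsto (fun N : ℕ ↦ ∑ i ∈ Finset.range j, (i : ℝ) / ((N : ℝ) - i)) atTop (𝓝 0) := by
  rw [← Finset.sum_const_zero (s := Finset.range j)]
  refine tendsto_finsetSum _ fun i _ ↦ ?_
  exact tendsto_const_nhds.div_atTop
    (tendsto_atTop_add_const_right _ _ tendsto_natCast_atTop_atTop)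

/-- The moments of the rescaled rows of a draw-and-delete cone converge to its diagonal. -/
theorem IsDrawDeleteCone.tendsto_sum_mul_pow {p : ℕ → ℕ → ℝ} (hp : IsDrawDeleteCone p)
    (h0 : ∀ K k, 0 ≤ p K k) (h1 : ∀ K, ∑ k ∈ Finset.range (K + 1), p K k = 1) (j : ℕ) :
    Tendsto (fun N : ℕ ↦ ∑ l ∈ Finset.range (N + 1), p N l * ((l : ℝ) / N) ^ j) atTop
      (𝓝 (p j j)) := by
  rw [tendsto_iff_dist_tendsto_zero]
  refine squeeze_zero' (.of_forall fun _ ↦ dist_nonneg) ?_ (tendsto_sum_div_sub_atTop j)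
  filter_upwards [eventually_ge_atTop j] with N hN
  have hdesc : (N.descFactorial j : ℝ) ≠ 0 := by
    exact_mod_cast (Nat.descFactorial_pos.2 hN).ne'
  have hmom : p j j = ∑ l ∈ Finset.range (N + 1),
      p N l * ((l.descFactorial j : ℝ) / N.descFactorial j) := by
    apply mul_left_cancel₀ hdesc
    rw [← hp.sum_descFactorial_mul hN, Finset.mul_sum]
    refine Finset.sum_congr rfl fun l _ ↦ ?_
    field_simp
  rw [dist_comm, Real.dist_eq, hmom, ← Finset.sum_sub_distrib]
  calc _ ≤ ∑ l ∈ Finset.range (N + 1),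
        p N l * |(l.descFactorial j : ℝ) / N.descFactorial j - ((l : ℝ) / N) ^ j| := by
        refine (Finset.abs_sum_le_sum_abs _ _).trans_eq (Finset.sum_congr rfl fun l _ ↦ ?_)
        rw [← mul_sub, abs_mul, abs_of_nonneg (h0 N l)]
    _ ≤ ∑ l ∈ Finset.range (N + 1), p N l * ∑ i ∈ Finset.range j, (i : ℝ) / (N - i) := by
        refine Finset.sum_le_sum fun l hl ↦ mul_le_mul_of_nonneg_left ?_ (h0 N l)
        exact abs_descFactorial_div_sub_pow_le hN (by simpa [Nat.lt_succ_iff] using hl)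
    _ = _ := by rw [← Finset.sum_mul, h1, one_mul]

theorem integral_eq_sum_range_of_Ioi_null {m : Measure ℕ} [IsFiniteMeasure m] {N : ℕ}
    (hm : m (Set.Ioi N) = 0) (g : ℕ → ℝ) :
    ∫ l, g l ∂m = ∑ l ∈ Finset.range (N + 1), m.real {l} * g l := by
  have hs : m ((Finset.range (N + 1) : Set ℕ)ᶜ) = 0 := by
    convert hm using 2
    ext l
    simp
  have hr := Measure.restrict_eq_self_of_ae_mem
    (show ∀ᵐ l ∂m, l ∈ (Finset.range (N + 1) : Set ℕ) from hs)
  calc ∫ l, g l ∂m = ∫ l in (Finset.range (N + 1) : Set ℕ), g l ∂m := by rw [hr]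
    _ = _ := by
      rw [setIntegral_finset]
      · rfl
      · exact IntegrableOn.finset

/-- De Finetti's theorem for a single draw-and-delete cone of probability measures. -/
theorem exists_probabilityMeasure_integral_bernstein (m : ℕ → Measure ℕ)
    [∀ K, IsProbabilityMeasure (m K)] (hsupp : ∀ K, m K (Set.Ioi K) = 0)
    (hm : IsDrawDeleteCone fun K k ↦ (m K).real {k}) :
    ∃ μ : ProbabilityMeasure I, ∀ K k, k ≤ K →
      (m K).real {k} = ∫ x, bernstein K k x ∂(μ : Measure I) := by
  let r (N l : ℕ) : I := Set.projIcc 0 1 zero_le_one ((l : ℝ) / N)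
  let ν (N : ℕ) : ProbabilityMeasure I :=
    ⟨(m N).map (r N), Measure.isProbabilityMeasure_map (by fun_prop)⟩
  let U : Ultrafilter ℕ := hyperfilter ℕ
  obtain ⟨μ, -, hμ⟩ := isCompact_univ.ultrafilter_le_nhds (U.map ν) (by simp)
  have hν : Tendsto ν U (𝓝 μ) := hμ
  have hU : (U : Filter ℕ) ≤ atTop := Nat.hyperfilter_le_atTop
  refine ⟨μ, fun K k hk ↦ hm.eq_of_diag (isDrawDeleteCone_integral_bernstein _) (fun j ↦ ?_) hk⟩
  have hsum (K : ℕ) : ∑ k ∈ Finset.range (K + 1), (m K).real {k} = 1 := by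
    have := integral_eq_sum_range_of_Ioi_null (hsupp K) (fun _ ↦ 1)
    simpa using this.symm
  have hlim := (hm.tendsto_sum_mul_pow (fun _ _ ↦ measureReal_nonneg) hsum j).mono_left hU
  have hlim' := ProbabilityMeasure.tendsto_iff_forall_integral_tendsto.1 hν
    (BoundedContinuousFunction.mkOfCompact (bernstein j j))
  refine tendsto_nhds_unique hlim (hlim'.congr fun N ↦ ?_)
  simp only [ν, ProbabilityMeasure.coe_mk, BoundedContinuousFunction.mkOfCompact_apply]
  rw [integral_map (by fun_prop) (bernstein j j).continuous.aestronglyMeasurable,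
    integral_eq_sum_range_of_Ioi_null (hsupp N)]
  refine Finset.sum_congr rfl fun l hl ↦ ?_
  have hl : l ≤ N := by simpa [Nat.lt_succ_iff] using hl
  have hmem : (l : ℝ) / N ∈ Set.Icc (0 : ℝ) 1 :=
    ⟨by positivity, div_le_one_of_le₀ (by exact_mod_cast hl) (by positivity)⟩
  simp [bernstein_apply, r, Set.projIcc_of_mem _ hmem]

/-- The integral of a continuous function is determined by the Bernstein integrals. -/
theorem tendsto_sum_integral_bernstein (μ : Measure I) [IsFiniteMeasure μ] (f : C(I, ℝ)) :
    Tendsto (fun n : ℕ ↦ ∑ k : Fin (n + 1), (∫ x, bernstein n k x ∂μ) * f (bernstein.z k)) atTop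
      (𝓝 (∫ x, f x ∂μ)) := by
  have hint (g : C(I, ℝ)) : Integrable (fun x ↦ g x) μ :=
    g.continuous.integrable_of_hasCompactSupport (HasCompactSupport.of_compactSpace _)
  have hunif := bernsteinApproximation_uniform f
  have hconv : Tendsto (fun n ↦ ∫ x, bernsteinApproximation n f x ∂μ) atTop
      (𝓝 (∫ x, f x ∂μ)) := by
    refine tendsto_integral_filter_of_norm_le_const
      (.of_forall fun n ↦ (hint _).aestronglyMeasurable) ⟨‖f‖ + 1, ?_⟩ (.of_forall fun x ↦ ?_)
    · filter_upwards [hunif.norm.eventually_le_const (lt_add_one _)] with n hn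
      exact .of_forall fun x ↦ (ContinuousMap.norm_coe_le_norm _ x).trans hn
    · exact ((continuous_eval_const x).tendsto f).comp hunif
  refine hconv.congr fun n ↦ ?_
  simp only [bernsteinApproximation.apply, smul_eq_mul]
  rw [integral_finsetSum _ fun (k : Fin (n + 1)) _ ↦ (hint (bernstein n (k : ℕ))).mul_const _]
  simp_rw [integral_mul_const]

theorem measure_eq_of_integral_bernstein_eq {μ ν : Measure I} [IsFiniteMeasure μ]
    [IsFiniteMeasure ν]
    (h : ∀ K k, k ≤ K → ∫ x, bernstein K k x ∂μ = ∫ x, bernstein K k x ∂ν) : μ = ν := by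
  refine ext_of_forall_integral_eq_of_IsFiniteMeasure fun f ↦ ?_
  refine tendsto_nhds_unique (tendsto_sum_integral_bernstein μ f.toContinuousMap)
    ((tendsto_sum_integral_bernstein ν f.toContinuousMap).congr fun n ↦ ?_)
  exact Finset.sum_congr rfl fun k _ ↦ by rw [h n k k.is_le]

/-- A family of probability measures on a metric space is measurable as soon as the integrals of
bounded continuous functions are. -/
theorem measurable_of_measurable_integral {Y X : Type*} [MeasurableSpace Y]
    [PseudoEMetricSpace X] [MeasurableSpace X] [BorelSpace X] {μ : Y → Measure X}
    [∀ y, IsProbabilityMeasure (μ y)]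
    (h : ∀ f : BoundedContinuousFunction X ℝ, Measurable fun y ↦ ∫ x, f x ∂(μ y)) :
    Measurable μ := by
  refine .measure_of_isPiSystem_of_isProbabilityMeasure
    ((BorelSpace.measurable_eq (α := X)).trans borel_eq_generateFrom_isClosed) isPiSystem_isClosed
    fun F hF ↦ ?_
  have hpos (n : ℕ) : (0 : ℝ) < 1 / ((n : ℝ) + 1) := by positivity
  have hreal : Measurable fun y ↦ (μ y).real F := by
    refine measurable_of_tendsto_metrizable
      (f := fun n y ↦ ∫ x, (thickenedIndicator (hpos n) F x : ℝ) ∂(μ y)) (fun n ↦ ?_)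
      (tendsto_pi_nhds.2 fun y ↦ tendsto_integral_thickenedIndicator_of_isClosed (μ y) hF hpos
        tendsto_one_div_add_atTop_nhds_zero_nat)
    exact h ((thickenedIndicator (hpos n) F).comp _ (LipschitzWith.subtype_val _))
  simpa using hreal.ennreal_ofReal

/-- De Finetti's theorem, kernel/limit form: the unit interval with the binomial
channels is the limit of the draw-and-delete chain in the Kleisli category of the
Giry monad.  Given Markov kernels `c_K : Y ⤳ {0,…,K}` forming a cone over the
draw-and-delete chain, there is a unique Markov kernel `c : Y ⤳ [0,1]` with
`c_K(y)({k}) = ∫_0^1 C(K,k)·x^k·(1−x)^{K−k} d(c(y))(x)`. -/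
theorem deFinetti_kernel
    {Y : Type*} [MeasurableSpace Y]
    (c : (K : ℕ) → Kernel Y ℕ)
    (hmarkov : ∀ K, IsMarkovKernel (c K))
    (hsupp : ∀ K y, (c K) y (Set.Ioi K) = 0)
    (hcone : ∀ y K i, i ≤ K →
      (c K) y {i}
        = (((i : ℝ≥0∞) + 1) / ((K : ℝ≥0∞) + 1)) * (c (K + 1)) y {i + 1}
          + ((((K : ℝ≥0∞) + 1) - (i : ℝ≥0∞)) / ((K : ℝ≥0∞) + 1)) * (c (K + 1)) y {i}) :
    ∃! κ : Kernel Y (Set.Icc (0 : ℝ) 1), IsMarkovKernel κ ∧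
      ∀ y K k, k ≤ K →
        ((c K) y {k}).toReal
          = ∫ x, (K.choose k : ℝ) * (x : ℝ) ^ k * (1 - (x : ℝ)) ^ (K - k) ∂(κ y) := by
  have hp (y : Y) : IsDrawDeleteCone fun K k ↦ (c K y).real {k} := by
    intro K i hi
    have hiK : (i : ℝ≥0∞) ≤ (K : ℝ≥0∞) + 1 := by exact_mod_cast (show i ≤ K + 1 by omega)
    have h := congrArg ENNReal.toReal (hcone y K i hi)
    rw [ENNReal.toReal_add (by finiteness) (by finiteness), ENNReal.toReal_mul, ENNReal.toReal_mul,
      ENNReal.toReal_div, ENNReal.toReal_div, ENNReal.toReal_sub_of_le hiK (by finiteness),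
      ENNReal.toReal_add (by finiteness) (by finiteness),
      ENNReal.toReal_add (by finiteness) (by finiteness)] at h
    simp only [ENNReal.toReal_natCast, ENNReal.toReal_one] at h
    simp only [Measure.real]
    rw [h]
    field_simp
  choose μ hμ using fun y ↦
    exists_probabilityMeasure_integral_bernstein (fun K ↦ c K y) (fun K ↦ hsupp K y) (hp y)
  have hmeas : Measurable fun y ↦ (μ y : Measure I) := by
    refine measurable_of_measurable_integral fun f ↦ ?_
    refine measurable_of_tendsto_metrizable (fun n ↦ ?_) (tendsto_pi_nhds.2 fun y ↦
      tendsto_sum_integral_bernstein (μ y : Measure I) f.toContinuousMap)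
    refine Finset.measurable_sum _ fun k _ ↦ Measurable.mul_const ?_ _
    simp_rw [← hμ _ n k k.is_le]
    exact ((c n).measurable_coe (measurableSet_singleton _)).ennreal_toReal
  refine ⟨⟨fun y ↦ μ y, hmeas⟩, ⟨⟨fun y ↦ (μ y).2⟩, fun y K k hk ↦ ?_⟩, fun κ hκ ↦ ?_⟩
  · simp_rw [← bernstein_apply]
    exact hμ y K k hk
  · have := hκ.1
    ext1 y
    refine measure_eq_of_integral_bernstein_eq (ν := (μ y : Measure I)) fun K k hk ↦ ?_
    rw [← hμ y K k hk]
    simp_rw [bernstein_apply]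
    exact (hκ.2 y K k hk).symm
end
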